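/- For every integer d ≥ 1, the scaled cube ((s_{d+1} − 1)/(s_{d+1} − 2)) · [0,1]^d is contained in the simplex T_d; that is, every point y ∈ ℝ^d with 0 ≤ y_i ≤ (s_{d+1} − 1)/(s_{d+1} − 2) for all i belongs to T_d. -/

import Mathlib

open MeasureTheory ENNReal

noncomputable section

/-- Auxiliary recursion for the Sylvester sequence: `s_{i+1} = s_i (s_i - 1) + 1`,
which is equivalent to `s_i = 1 + s_1 ⋯ s_{i-1}` with `s_1 = 2`. -/
def sylAux : ℕ → ℕ
  | 0 => 2
  | n + 1 => sylAux n * (sylAux n - 1) + 1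

/-- The Sylvester sequence `s_1 = 2`, `s_i = 1 + s_1 s_2 ⋯ s_{i-1}` (1-indexed). -/
def syl (n : ℕ) : ℕ := sylAux (n - 1)

/-- The standard basis vector `e_i` of `ℝ^d`. -/
def stdBasis (d : ℕ) (i : Fin d) : Fin d → ℝ := Pi.single i 1

/-- The integer lattice `ℤ^d`, viewed as a subset of `ℝ^d`. -/
def latticePts (d : ℕ) : Set (Fin d → ℝ) :=
  Set.range fun z : Fin d → ℤ => fun i => (z i : ℝ)

/-- The simplex `T_d = conv(0, s_1 e_1, …, s_d e_d)`. -/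
def Td (d : ℕ) : Set (Fin d → ℝ) :=
  convexHull ℝ (insert 0 (Set.range fun i : Fin d => (syl (i.1 + 1) : ℝ) • stdBasis d i))

theorem sylAux_two_le (n : ℕ) : 2 ≤ sylAux n := by
  induction n with
  | zero => simp [sylAux]
  | succ k ih =>
    obtain ⟨m, hm⟩ := Nat.exists_eq_add_of_le ih
    simp only [sylAux, hm]
    have : 2 + m - 1 = m + 1 := by omega
    rw [this]
    nlinarith

theorem sylAux_cast_succ (n : ℕ) :
    (sylAux (n + 1) : ℝ) = sylAux n * ((sylAux n : ℝ) - 1) + 1 := by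
  have h := sylAux_two_le n
  simp only [sylAux]
  rw [Nat.cast_add, Nat.cast_mul, Nat.cast_sub (by omega)]
  simp

theorem sylAux_sum (d : ℕ) :
    ∑ i ∈ Finset.range d, (1 : ℝ) / sylAux i = 1 - 1 / ((sylAux d : ℝ) - 1) := by
  induction d with
  | zero => norm_num [sylAux]
  | succ k ih =>
    have h : (2 : ℝ) ≤ sylAux k := by exact_mod_cast sylAux_two_le k
    rw [Finset.sum_range_succ, ih, sylAux_cast_succ]
    have h1 : (sylAux k : ℝ) - 1 ≠ 0 := by linarith
    have h2 : (sylAux k : ℝ) ≠ 0 := by linarith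
    rw [add_sub_cancel_right]
    field_simp
    ring

theorem sylAux_three_le (d : ℕ) (hd : 1 ≤ d) : (3 : ℝ) ≤ sylAux d := by
  obtain ⟨k, rfl⟩ := Nat.exists_eq_add_of_le' hd
  have h : (2 : ℝ) ≤ sylAux k := by exact_mod_cast sylAux_two_le k
  rw [sylAux_cast_succ]
  nlinarith

/-- For every `d ≥ 1`, the scaled cube `((s_{d+1} - 1)/(s_{d+1} - 2)) · [0,1]^d` is
contained in the simplex `T_d`: every point `y` with
`0 ≤ y_i ≤ (s_{d+1} - 1)/(s_{d+1} - 2)` for all `i` belongs to `T_d`. -/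
theorem scaled_cube_subset_Td (d : ℕ) (hd : 1 ≤ d) (y : Fin d → ℝ)
    (hy : ∀ i, 0 ≤ y i ∧ y i ≤ ((syl (d + 1) : ℝ) - 1) / ((syl (d + 1) : ℝ) - 2)) :
    y ∈ Td d := by
  simp only [syl, Nat.add_sub_cancel] at hy
  have h3 := sylAux_three_le d hd
  have hpos : ∀ n, (0 : ℝ) < sylAux n := fun n => by
    have := sylAux_two_le n
    exact_mod_cast (by omega : 0 < sylAux n)
  have hsum : ∑ i : Fin d, y i / sylAux i ≤ 1 := by
    calc ∑ i : Fin d, y i / sylAux i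
        ≤ ∑ i : Fin d, (((sylAux d : ℝ) - 1) / ((sylAux d : ℝ) - 2)) * (1 / sylAux i) := by
          refine Finset.sum_le_sum fun i _ => ?_
          rw [div_eq_mul_one_div]
          exact mul_le_mul_of_nonneg_right (hy i).2 (one_div_pos.2 (hpos i)).le
      _ = (((sylAux d : ℝ) - 1) / ((sylAux d : ℝ) - 2)) * (1 - 1 / ((sylAux d : ℝ) - 1)) := by
          rw [← Finset.mul_sum, Fin.sum_univ_eq_sum_range (fun i => (1 : ℝ) / sylAux i),
            sylAux_sum]
      _ = 1 := by
          have h1 : (sylAux d : ℝ) - 1 ≠ 0 := by linarith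
          have h2 : (sylAux d : ℝ) - 2 ≠ 0 := by linarith
          field_simp
          ring
      _ ≤ 1 := le_rfl
  have hc : Convex ℝ (Td d) := convex_convexHull ℝ _
  let w : Option (Fin d) → ℝ := fun o =>
    o.elim (1 - ∑ i : Fin d, y i / sylAux i) (fun i => y i / sylAux i)
  let z : Option (Fin d) → (Fin d → ℝ) := fun o =>
    o.elim 0 (fun i => (syl (i.1 + 1) : ℝ) • stdBasis d i)
  have key : ∑ o, w o • z o ∈ Td d := by
    refine hc.sum_mem ?_ ?_ ?_
    · rintro (_ | i) _
      · simpa [w] using hsum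
      · exact div_nonneg (hy i).1 (hpos i).le
    · simp [w, Fintype.sum_option]
    · rintro (_ | i) _
      · exact subset_convexHull ℝ _ (Set.mem_insert _ _)
      · exact subset_convexHull ℝ _ (Set.mem_insert_of_mem _ ⟨i, rfl⟩)
  convert key using 1
  ext j
  rw [Fintype.sum_option]
  have hj := (hpos j).ne'
  simp [w, z, syl, stdBasis, Finset.sum_apply, Pi.single_apply]
  field_simp
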